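/- arXiv:1912.11307 — 7 statements merged into one kernel-verified Lean document; each statement's English description precedes it below -/
import Mathlib

section
/- Let (M,φ) be a flow on a compact metric space M. If the time-one map (M,φ_1) has a weak horseshoe with bounded-gap-hitting times, then for every real number τ ≠ 0 the homeomorphism (M,φ_τ) has a weak horseshoe with bounded-gap-hitting times. -/
/-- A homeomorphism (given as a bijection `T` of a topological space) has a *weak horseshoe
with bounded-gap-hitting times* if there are two disjoint nonempty closed subsets `U 0, U 1`,
a constant `K > 0` and a subset `J = {n i}_{i ∈ ℤ}` of `ℤ` with `0 < n (i+1) - n i < K`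
for all `i`, such that for every `s ∈ {0,1}^J` there is `x` with `T^j x ∈ U (s j)` for all
`j ∈ J`. -/
def HasWeakHorseshoeBGH {X : Type*} [TopologicalSpace X] (T : Equiv.Perm X) : Prop :=
  ∃ (U : Fin 2 → Set X) (K : ℤ) (n : ℤ → ℤ),
    (∀ k, IsClosed (U k)) ∧ (∀ k, (U k).Nonempty) ∧ Disjoint (U 0) (U 1) ∧
    0 < K ∧ (∀ i : ℤ, 0 < n (i + 1) - n i ∧ n (i + 1) - n i < K) ∧
    ∀ s : ℤ → Fin 2, ∃ x : X, ∀ i : ℤ, (T ^ n i) x ∈ U (s (n i))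

/-- The time-`t` map of a flow `φ`, as a bijection of the phase space. -/
def flowMap {M : Type*} (φ : M × ℝ → M) (h0 : ∀ x, φ (x, 0) = x)
    (hadd : ∀ (x : M) (t s : ℝ), φ (φ (x, s), t) = φ (x, t + s)) (t : ℝ) :
    Equiv.Perm M where
  toFun x := φ (x, t)
  invFun x := φ (x, -t)
  left_inv x := by
    show φ (φ (x, t), -t) = x
    rw [hadd]; simp [h0]
  right_inv x := by
    show φ (φ (x, -t), t) = x
    rw [hadd]; simp [h0]

open Filter Topology

/-- A set of integers is piecewise syndetic if it has bounded gaps on arbitrarily long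
intervals. -/
def IsPiecewiseSyndetic (C : Set ℤ) : Prop :=
  ∃ K : ℤ, ∀ L : ℕ, ∃ a : ℤ, ∀ x ∈ Set.Icc (a - L) (a + L), ∃ y ∈ Set.Icc x (x + K), y ∈ C

/-- A set `C` of times is independent for `(U 0, U 1)` under `T` if every itinerary along `C` is
realised. -/
def IsIndependentTimeSet {X : Type*} (T : Equiv.Perm X) (U : Fin 2 → Set X) (C : Set ℤ) : Prop :=
  ∀ s : ℤ → Fin 2, ∃ x : X, ∀ j ∈ C, (T ^ j) x ∈ U (s j)

lemma IsPiecewiseSyndetic.of_union {A B : Set ℤ} (h : IsPiecewiseSyndetic (A ∪ B)) :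
    IsPiecewiseSyndetic A ∨ IsPiecewiseSyndetic B := by
  by_contra! hAB
  obtain ⟨hA, hB⟩ := hAB
  obtain ⟨K, hK⟩ := h
  unfold IsPiecewiseSyndetic at hB
  push Not at hB
  obtain ⟨L₀, hL₀⟩ := hB K
  refine hA ⟨2 * L₀ + K, fun L => ?_⟩
  obtain ⟨a, ha⟩ := hK (L + 2 * L₀)
  refine ⟨a, fun x hx => ?_⟩
  obtain ⟨x', hx', hx'B⟩ := hL₀ (x + L₀)
  simp only [Set.mem_Icc] at hx hx'
  obtain ⟨y, hy, hyAB⟩ := ha x' ⟨by push_cast; lia, by push_cast; lia⟩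
  refine ⟨y, ?_, hyAB.resolve_right (hx'B y hy)⟩
  simp only [Set.mem_Icc] at hy ⊢
  lia

lemma IsPiecewiseSyndetic.exists_of_biUnion {ι : Type*} (S : Finset ι) (C : ι → Set ℤ)
    (h : IsPiecewiseSyndetic (⋃ c ∈ S, C c)) : ∃ c ∈ S, IsPiecewiseSyndetic (C c) := by
  classical
  induction S using Finset.induction_on with
  | empty =>
    obtain ⟨K, hK⟩ := h
    obtain ⟨a, ha⟩ := hK 0
    obtain ⟨y, -, hy⟩ := ha a (by simp)
    simp at hy
  | insert c S _ ih =>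
    rw [Finset.set_biUnion_insert] at h
    rcases h.of_union with h | h
    · exact ⟨c, Finset.mem_insert_self c S, h⟩
    · obtain ⟨d, hd, hdC⟩ := ih h
      exact ⟨d, Finset.mem_insert_of_mem hd, hdC⟩

/-- On a compact space, a piecewise syndetic independent time set can be replaced, via a limit of
translates, by a syndetic one. -/
lemma IsIndependentTimeSet.exists_syndetic {X : Type*} [TopologicalSpace X] [CompactSpace X]
    {T : Equiv.Perm X} (hT : ∀ m : ℤ, Continuous (T ^ m)) {U : Fin 2 → Set X}
    (hU : ∀ k, IsClosed (U k)) {C : Set ℤ} (hind : IsIndependentTimeSet T U C)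
    (hC : IsPiecewiseSyndetic C) :
    ∃ (A : Set ℤ) (K : ℤ), IsIndependentTimeSet T U A ∧ ∀ x, ∃ y ∈ Set.Icc x (x + K), y ∈ A := by
  obtain ⟨K, hK⟩ := hC
  choose a ha using hK
  let F : Ultrafilter ℕ := hyperfilter ℕ
  have hF : (F : Filter ℕ) ≤ atTop := by
    rw [← Nat.cofinite_eq_atTop]; exact hyperfilter_le_cofinite
  refine ⟨{m | ∀ᶠ L in (F : Filter ℕ), m + a L ∈ C}, K, fun s => ?_, fun x => ?_⟩
  · choose z hz using fun L : ℕ => hind fun j => s (j - a L)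
    obtain ⟨y, -, hy⟩ := isCompact_univ.ultrafilter_le_nhds
      (F.map fun L => (T ^ a L) (z L)) (by simp)
    refine ⟨y, fun m hm => ?_⟩
    have hlim : Tendsto (fun L => (T ^ m) ((T ^ a L) (z L))) F (𝓝 ((T ^ m) y)) :=
      ((hT m).tendsto y).comp hy
    refine (hU (s m)).mem_of_tendsto hlim ?_
    filter_upwards [hm] with L hL
    have := hz L _ hL
    rwa [zpow_add, Equiv.Perm.mul_apply, add_sub_cancel_right] at this
  · have hev : ∀ᶠ L in (F : Filter ℕ), ∃ y ∈ Set.Icc x (x + K), y + a L ∈ C := by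
      filter_upwards [hF (eventually_ge_atTop x.natAbs)] with L hL
      obtain ⟨y, hy, hyC⟩ := ha L (x + a L) ⟨by lia, by lia⟩
      simp only [Set.mem_Icc] at hy
      exact ⟨y - a L, ⟨by lia, by lia⟩, by simpa using hyC⟩
    exact (Ultrafilter.eventually_exists_mem_iff (Set.finite_Icc x (x + K))).1 hev

lemma HasWeakHorseshoeBGH.of_syndetic {X : Type*} [TopologicalSpace X] {T : Equiv.Perm X}
    {U : Fin 2 → Set X} (hcl : ∀ k, IsClosed (U k)) (hne : ∀ k, (U k).Nonempty)
    (hdisj : Disjoint (U 0) (U 1)) {A : Set ℤ} {K : ℤ} (hind : IsIndependentTimeSet T U A)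
    (hA : ∀ x, ∃ y ∈ Set.Icc x (x + K), y ∈ A) : HasWeakHorseshoeBGH T := by
  have hK : 0 ≤ K := by
    obtain ⟨y, hy, -⟩ := hA 0
    simp only [Set.mem_Icc] at hy
    lia
  choose n hn hnA using fun i : ℤ => hA ((K + 1) * i)
  simp only [Set.mem_Icc] at hn
  refine ⟨U, 2 * K + 2, n, hcl, hne, hdisj, by lia, fun i => ?_, fun s => ?_⟩
  · have h₁ := hn i
    have h₂ := hn (i + 1)
    rw [mul_add] at h₂
    constructor <;> lia
  · obtain ⟨x, hx⟩ := hind s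
    exact ⟨x, fun i => hx _ (hnA i)⟩

lemma exists_mem_Icc_of_gaps {n : ℤ → ℤ} {K : ℤ}
    (hn : ∀ i, 0 < n (i + 1) - n i ∧ n (i + 1) - n i < K) (z : ℤ) :
    ∃ i, n i ∈ Set.Icc z (z + K) := by
  have hsub : ∀ i j, i ≤ j → j - i ≤ n j - n i := by
    intro i j hij
    induction j, hij using Int.leInduction with
    | base => simp
    | succ j _ ih => have := hn j; lia
  obtain ⟨i, hi, hmax⟩ := Int.exists_greatest_of_bdd (P := fun i => n i < z)
    ⟨max 0 (z - n 0), fun i hi => by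
      by_contra! h
      have := hsub 0 i (by lia)
      lia⟩
    ⟨min 0 (z - n 0 - 1), by
      have := hsub (min 0 (z - n 0 - 1)) 0 (by lia)
      lia⟩
  have h : z ≤ n (i + 1) := by
    by_contra! h
    have := hmax _ h
    lia
  have := hn i
  exact ⟨i + 1, h, by lia⟩

lemma exists_floor_div_mem_Icc {n : ℤ → ℤ} {K : ℤ}
    (hn : ∀ i, 0 < n (i + 1) - n i ∧ n (i + 1) - n i < K) {τ : ℝ} (hτ : τ ≠ 0) :
    ∃ D : ℤ, ∀ x : ℤ, ∃ i, ⌊(n i : ℝ) / τ⌋ ∈ Set.Icc x (x + D) := by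
  refine ⟨2 * ⌈((K : ℝ) + 1) / |τ|⌉, fun x => ?_⟩
  set D : ℤ := ⌈((K : ℝ) + 1) / |τ|⌉
  obtain ⟨i, hi₁, hi₂⟩ := exists_mem_Icc_of_gaps hn ⌈((x + D : ℤ) : ℝ) * τ⌉
  have hτ' : 0 < |τ| := abs_pos.2 hτ
  have hdist : |(n i : ℝ) / τ - (x + D : ℤ)| ≤ D := by
    have h₁ : |(n i : ℝ) - (x + D : ℤ) * τ| ≤ K + 1 := by
      have h₂ := Int.le_ceil (((x + D : ℤ) : ℝ) * τ)
      have h₃ := Int.ceil_lt_add_one (((x + D : ℤ) : ℝ) * τ)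
      have h₄ : ((⌈((x + D : ℤ) : ℝ) * τ⌉ : ℤ) : ℝ) ≤ n i := by exact_mod_cast hi₁
      have h₅ : (n i : ℝ) ≤ (⌈((x + D : ℤ) : ℝ) * τ⌉ : ℤ) + K := by exact_mod_cast hi₂
      rw [abs_le]
      constructor <;> linarith
    rw [show (n i : ℝ) / τ - (x + D : ℤ) = ((n i : ℝ) - (x + D : ℤ) * τ) / τ by field_simp,
      abs_div]
    exact (div_le_div_of_nonneg_right h₁ hτ'.le).trans (Int.le_ceil _)
  rw [abs_le] at hdist
  push_cast at hdist
  refine ⟨i, Int.le_floor.2 (by linarith), ?_⟩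
  have h := (Int.floor_le ((n i : ℝ) / τ)).trans (show (n i : ℝ) / τ ≤ (x + 2 * D : ℤ) by
    push_cast; linarith)
  exact_mod_cast h

lemma flowMap_zpow_apply {M : Type*} (φ : M × ℝ → M) (h0 : ∀ x, φ (x, 0) = x)
    (hadd : ∀ (x : M) (t s : ℝ), φ (φ (x, s), t) = φ (x, t + s)) (t : ℝ) (m : ℤ) (x : M) :
    (flowMap φ h0 hadd t ^ m) x = φ (x, m * t) := by
  induction m using Int.induction_on with
  | zero => simp [h0]
  | succ m ih =>
    rw [add_comm, zpow_add, Equiv.Perm.mul_apply, ih, zpow_one]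
    change φ (φ (x, _), t) = _
    rw [hadd]
    push_cast
    ring_nf
  | pred m ih =>
    rw [sub_eq_add_neg, add_comm, zpow_add, Equiv.Perm.mul_apply, ih, zpow_neg_one]
    change φ (φ (x, _), -t) = _
    rw [hadd]
    push_cast
    ring_nf

/-- A flow needs a definite amount of time to move from a compact set into a disjoint closed
set. -/
lemma exists_pos_forall_flow_notMem {M : Type*} [TopologicalSpace M] {φ : M × ℝ → M}
    (hφ : Continuous φ) (h0 : ∀ x, φ (x, 0) = x) {A B : Set M} (hA : IsCompact A)
    (hB : IsClosed B) (hAB : Disjoint A B) :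
    ∃ δ > 0, ∀ t : ℝ, |t| < δ → ∀ u ∈ A, φ (u, t) ∉ B := by
  have hev : ∀ᶠ t in 𝓝 (0 : ℝ), ∀ u ∈ A, φ (u, t) ∉ B := by
    refine hA.eventually_forall_of_forall_eventually fun u hu => ?_
    refine (hφ.comp continuous_swap).continuousAt.eventually_mem
      (hB.isOpen_compl.mem_nhds ?_)
    simpa [h0] using hAB.notMem_of_mem_left hu
  obtain ⟨δ, hδ, h⟩ := Metric.eventually_nhds_iff.1 hev
  exact ⟨δ, hδ, fun t ht => h (by simpa using ht)⟩

/-- If the time-one map of a flow on a compact metric space has a weak horseshoe with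
bounded-gap-hitting times, then so does the time-`τ` map for every `τ ≠ 0`. -/
theorem time_tau_map_hasWeakHorseshoeBGH {M : Type*} [MetricSpace M] [CompactSpace M]
    (φ : M × ℝ → M) (hφ : Continuous φ)
    (h0 : ∀ x, φ (x, 0) = x)
    (hadd : ∀ (x : M) (t s : ℝ), φ (φ (x, s), t) = φ (x, t + s))
    (h1 : HasWeakHorseshoeBGH (flowMap φ h0 hadd 1))
    (τ : ℝ) (hτ : τ ≠ 0) :
    HasWeakHorseshoeBGH (flowMap φ h0 hadd τ) := by
  obtain ⟨U, K, n, hcl, hne, hdisj, -, hn, hs⟩ := h1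
  obtain ⟨δ, hδ, hδU⟩ :=
    exists_pos_forall_flow_notMem hφ h0 (hcl 0).isCompact (hcl 1) hdisj
  obtain ⟨N, hN⟩ := exists_nat_gt (|τ| / δ)
  have hN0 : (0 : ℝ) < N := (by positivity : 0 ≤ |τ| / δ).trans_lt hN
  have hNδ : |τ| * (1 / N) < δ := by
    rw [div_lt_iff₀ hδ] at hN
    rw [mul_one_div, div_lt_iff₀ hN0]
    linarith
  let I : ℕ → Set ℝ := fun c => Set.Icc ((c : ℝ) / N) ((c + 1) / N)
  let C : ℕ → Set ℤ := fun c =>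
    {m | ∃ i, ⌊(n i : ℝ) / τ⌋ = m ∧ Int.fract ((n i : ℝ) / τ) ∈ I c}
  let V : ℕ → Fin 2 → Set M := fun c k =>
    (fun p : M × ℝ => φ (p.1, -(τ * p.2))) '' (U k ×ˢ I c)
  have hPS : IsPiecewiseSyndetic (⋃ c ∈ Finset.range N, C c) := by
    obtain ⟨D, hD⟩ := exists_floor_div_mem_Icc hn hτ
    refine ⟨D, fun _ => ⟨0, fun x _ => ?_⟩⟩
    obtain ⟨i, hi⟩ := hD x
    set r := Int.fract ((n i : ℝ) / τ) with hr
    have hr0 : 0 ≤ r := Int.fract_nonneg _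
    have hr1 : r < 1 := Int.fract_lt_one _
    refine ⟨_, hi, Set.mem_biUnion (x := ⌊r * N⌋₊) ?_ ⟨i, rfl, ?_, ?_⟩⟩
    · rw [Finset.mem_coe, Finset.mem_range, Nat.floor_lt (by positivity)]
      nlinarith
    · rw [div_le_iff₀ hN0]
      exact Nat.floor_le (by positivity)
    · rw [le_div_iff₀ hN0]
      exact (Nat.lt_floor_add_one _).le
  obtain ⟨c, -, hc⟩ := hPS.exists_of_biUnion
  have hVcl : ∀ k, IsClosed (V c k) := fun k =>
    (((hcl k).isCompact.prod isCompact_Icc).image (by fun_prop)).isClosed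
  have hVne : ∀ k, (V c k).Nonempty := fun k =>
    ((hne k).prod (Set.nonempty_Icc.2 (by gcongr; simp))).image _
  have hVdisj : Disjoint (V c 0) (V c 1) := by
    rw [Set.disjoint_left]
    rintro _ ⟨⟨u, r⟩, ⟨hu, hr⟩, rfl⟩ ⟨⟨v, r'⟩, ⟨hv, hr'⟩, h⟩
    refine hδU (τ * (r' - r)) ?_ u hu ?_
    · rw [abs_mul]
      refine lt_of_le_of_lt ?_ hNδ
      gcongr
      simp only [I, Set.mem_Icc, add_div] at hr hr'
      rw [abs_le]
      constructor <;> linarith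
    · have h' := congrArg (fun y => φ (y, τ * r')) h
      simp only [hadd, add_neg_cancel, h0] at h'
      rw [← sub_eq_add_neg, ← mul_sub] at h'
      exact h' ▸ hv
  have hind : IsIndependentTimeSet (flowMap φ h0 hadd τ) (V c) (C c) := by
    intro s
    obtain ⟨x, hx⟩ := hs fun j => s ⌊(j : ℝ) / τ⌋
    refine ⟨x, ?_⟩
    rintro _ ⟨i, rfl, hi⟩
    refine ⟨(φ (x, n i), Int.fract ((n i : ℝ) / τ)), ⟨?_, hi⟩, ?_⟩
    · simpa [flowMap_zpow_apply] using hx i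
    · simp only [hadd, flowMap_zpow_apply]
      congr 2
      rw [Int.fract]
      field_simp
      ring
  obtain ⟨A, D, hA, hAD⟩ := hind.exists_syndetic
    (fun m => by
      rw [funext (flowMap_zpow_apply φ h0 hadd τ m)]
      fun_prop) hVcl hc
  exact .of_syndetic hVcl hVne hVdisj hA hAD
end

section
/- Let T be a homeomorphism of a compact metric space X. If (X,T) has a weak horseshoe with bounded-gap-hitting times, then (X,T) has infinitely many minimal sets (i.e., there are infinitely many nonempty closed T-invariant subsets of X that are minimal with respect to inclusion). -/
/-- A *minimal set* of the system given by a homeomorphism `T` : a nonempty closed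
`T`-invariant set containing no proper nonempty closed `T`-invariant subset. -/
def IsMinimalSet {X : Type*} [TopologicalSpace X] (T : Equiv.Perm X) (A : Set X) : Prop :=
  A.Nonempty ∧ IsClosed A ∧ T '' A = A ∧
    ∀ B : Set X, B ⊆ A → B.Nonempty → IsClosed B → T '' B = B → B = A

/-- A nonempty closed invariant set of a homeomorphism of a compact space contains a minimal set. -/
theorem exists_isMinimalSet_subset {X : Type*} [TopologicalSpace X] [CompactSpace X]
    (T : Equiv.Perm X) {C : Set X} (hne : C.Nonempty) (hC : IsClosed C) (hTC : T '' C = C) :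
    ∃ A ⊆ C, IsMinimalSet T A := by
  obtain ⟨A, hAC, hA⟩ := zorn_superset_nonempty
    {A : Set X | A.Nonempty ∧ IsClosed A ∧ T '' A = A} (fun c hc hchain hcne => by
      refine ⟨⋂₀ c, ⟨?_, isClosed_sInter fun A hA => (hc hA).2.1, ?_⟩,
        fun A hA => Set.sInter_subset_of_mem hA⟩
      · have : Nonempty c := hcne.to_subtype
        have hdir : DirectedOn (· ⊇ ·) c := fun A hA B hB =>
          (hchain.total hA hB).elim (fun h => ⟨A, hA, subset_rfl, h⟩) fun h => ⟨B, hB, h, subset_rfl⟩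
        exact IsCompact.nonempty_sInter_of_directed_nonempty_isCompact_isClosed hdir
          (fun A hA => (hc hA).1) (fun A hA => (hc hA).2.1.isCompact) (fun A hA => (hc hA).2.1)
      · rw [Set.sInter_eq_biInter, Set.image_iInter₂ T.bijective]
        exact Set.iInter₂_congr fun A hA => (hc hA).2.2) C ⟨hne, hC, hTC⟩
  exact ⟨A, hAC, hA.prop.1, hA.prop.2.1, hA.prop.2.2, fun B hBA h₁ h₂ h₃ =>
    hBA.antisymm (hA.le_of_le ⟨h₁, h₂, h₃⟩ hBA)⟩

/-- The orbit closure of every point contains a minimal set. -/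
theorem exists_isMinimalSet_subset_closure_orbit {X : Type*} [TopologicalSpace X] [CompactSpace X]
    (T : Equiv.Perm X) (hT : Continuous T) (hT' : Continuous T.symm) (x : X) :
    ∃ A ⊆ closure (Set.range fun t : ℤ => (T ^ t) x), IsMinimalSet T A := by
  refine exists_isMinimalSet_subset T (Set.range_nonempty _).closure isClosed_closure ?_
  have h := (Homeomorph.mk T hT hT').image_closure (Set.range fun t : ℤ => (T ^ t) x)
  refine h.trans (congrArg closure ?_)
  ext y
  simp only [Set.mem_image, Set.mem_range, exists_exists_eq_and]
  constructor
  · rintro ⟨t, rfl⟩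
    exact ⟨1 + t, by simp [zpow_add]⟩
  · rintro ⟨t, rfl⟩
    refine ⟨t - 1, ?_⟩
    change T ((T ^ (t - 1)) x) = _
    rw [← Equiv.Perm.mul_apply, ← zpow_one_add]
    congr 2
    ring

/-- A bi-infinite integer sequence with gaps in `(0, K)` visits every interval of length `K`. -/
theorem exists_mem_Ico_of_bounded_gaps {K : ℤ} {n : ℤ → ℤ}
    (hn : ∀ i : ℤ, 0 < n (i + 1) - n i ∧ n (i + 1) - n i < K) (a : ℤ) :
    ∃ i, n i ∈ Set.Ico a (a + K) := by
  have hmono : Monotone fun i => n i - i :=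
    monotone_int_of_le_succ fun i => by have := (hn i).1; lia
  obtain ⟨i, hi, hmax⟩ := Int.exists_greatest_of_bdd (P := fun i => n i < a)
    ⟨max 0 (a - n 0), fun i hi => by
      by_contra! hlt
      have := hmono (show 0 ≤ i by lia)
      simp only at this
      lia⟩
    ⟨min 0 (a - n 0 - 1), by
      have := hmono (min_le_left 0 (a - n 0 - 1))
      simp only at this
      lia⟩
  refine ⟨i + 1, ?_, by have := (hn i).2; lia⟩
  by_contra! hlt
  have := hmax _ hlt
  lia

/-- There is a binary sequence in which every word of length `K` occurs before a fixed time `N`. -/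
theorem exists_seq_containing_all_words (K : ℕ) :
    ∃ (N : ℕ) (σ : ℕ → Fin 2) (c : (Fin K → Fin 2) → ℕ),
      ∀ w (d : Fin K), c w + d < N ∧ σ (c w + d) = w d := by
  classical
  let e := Fintype.equivFin (Fin K → Fin 2)
  let word : ℕ → Fin K → Fin 2 := fun r =>
    if h : r < Fintype.card (Fin K → Fin 2) then e.symm ⟨r, h⟩ else 0
  refine ⟨K * Fintype.card (Fin K → Fin 2),
    fun r => if h : r % K < K then word (r / K) ⟨r % K, h⟩ else 0, fun w => K * e w,
    fun w d => ⟨?_, ?_⟩⟩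
  · calc K * (e w : ℕ) + d < K * (e w + 1) := by rw [mul_add_one]; have := d.2; lia
      _ ≤ _ := Nat.mul_le_mul_left _ (e w).2
  · have hK : 0 < K := d.pos
    have h₁ : (K * (e w : ℕ) + d) / K = e w := by
      rw [Nat.mul_add_div hK, Nat.div_eq_of_lt d.2, add_zero]
    have h₂ : (K * (e w : ℕ) + d) % K = d := by
      rw [Nat.mul_add_mod, Nat.mod_eq_of_lt d.2]
    have h₃ := (e w).2
    simp only [h₁, h₂, d.2, h₃, word, dif_pos, Fin.eta, Equiv.symm_apply_apply]

/-- A simultaneous shift making finitely many integers congruent to prescribed residues modulo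
distinct primes can be found below the product of the primes. -/
theorem exists_lt_prod_forall_modEq {ι : Type*} [Fintype ι] {q : ι → ℕ}
    (hq : ∀ i, (q i).Prime) (hinj : Function.Injective q) (t c : ι → ℤ) :
    ∃ l < ∏ i, q i, ∀ i, (l : ℤ) + t i ≡ c i [ZMOD q i] := by
  have hpos : ∀ i ∈ Finset.univ, q i ≠ 0 := fun i _ => (hq i).ne_zero
  have hcop : Set.Pairwise (↑(Finset.univ : Finset ι)) (Function.onFun Nat.Coprime q) :=
    fun i _ j _ hij => (Nat.coprime_primes (hq i) (hq j)).2 (hinj.ne hij)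
  let a : ι → ℕ := fun i => ((c i - t i) % q i).toNat
  refine ⟨Nat.chineseRemainderOfFinset a q Finset.univ hpos hcop,
    Nat.chineseRemainderOfFinset_lt_prod a q hpos hcop, fun i => ?_⟩
  have h := (Nat.chineseRemainderOfFinset a q Finset.univ hpos hcop).2 i (Finset.mem_univ i)
  have ha : (a i : ℤ) = (c i - t i) % q i :=
    Int.toNat_of_nonneg (Int.emod_nonneg _ (by exact_mod_cast (hq i).ne_zero))
  have h' := (Int.natCast_modEq_iff.2 h).trans (ha ▸ Int.mod_modEq _ _)
  simpa using h'.add_right (t i)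

/-- A homeomorphism of a compact metric space with a weak horseshoe with
bounded-gap-hitting times has infinitely many minimal sets. -/
theorem hasWeakHorseshoeBGH_infinite_minimal_sets {X : Type*} [MetricSpace X] [CompactSpace X]
    (T : Equiv.Perm X) (hT : Continuous T) (hT' : Continuous T.symm)
    (h : HasWeakHorseshoeBGH T) :
    {A : Set X | IsMinimalSet T A}.Infinite := by
  classical
  obtain ⟨U, K, n, hU, -, hdisj, hK, hn, hs⟩ := h
  lift K to ℕ using hK.le
  obtain ⟨N, σ, c, hσ⟩ := exists_seq_containing_all_words K
  intro hfin
  let P := {p : ℕ // p.Prime ∧ N ≤ p}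
  have : Infinite P := by
    refine Set.infinite_coe_iff.2 (Set.infinite_of_not_bddAbove ?_)
    rintro ⟨b, hb⟩
    obtain ⟨p, hp, hpp⟩ := Nat.exists_infinite_primes (max N (b + 1))
    have := hb (show p ∈ {p : ℕ | p.Prime ∧ N ≤ p} from ⟨hpp, by lia⟩)
    lia
  choose x hx using fun p : P => hs fun j => σ (j % (p : ℕ)).toNat
  choose M hMx hM using fun p => exists_isMinimalSet_subset_closure_orbit T hT hT' (x p)
  have : Finite {A : Set X | IsMinimalSet T A} := hfin
  obtain ⟨A, hA⟩ := Finite.exists_infinite_fiber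
    (fun p => (⟨M p, hM p⟩ : {A : Set X | IsMinimalSet T A}))
  obtain ⟨z, hz⟩ := A.2.1
  let f := (Fintype.equivFin (Fin K → Fin 2)).toEmbedding.trans
    (Fin.valEmbedding.trans (@Infinite.natEmbedding _ hA))
  let q : (Fin K → Fin 2) → P := fun w => (f w).1
  have hqinj : Function.Injective fun w => (q w : ℕ) :=
    Subtype.val_injective.comp (Subtype.val_injective.comp f.injective)
  have hqM : ∀ w, M (q w) = A := fun w => congrArg Subtype.val (f w).2
  set L := ∏ w, (q w : ℕ)
  -- Points near `z` visit `U k` during a bounded time only when `z` does.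
  have hnhds : ∀ᶠ y in nhds z, ∀ l ∈ Set.Iio (L + K), ∀ k : Fin 2,
      (T ^ l) y ∈ U k → (T ^ l) z ∈ U k := by
    rw [Filter.eventually_all_finite (Set.finite_Iio _)]
    intro l _
    rw [Filter.eventually_all]
    intro k
    by_cases hzk : (T ^ l) z ∈ U k
    · exact Filter.Eventually.of_forall fun _ _ => hzk
    · have hcont : Continuous (T ^ l : Equiv.Perm X) := by
        rw [← Equiv.Perm.iterate_eq_pow]
        exact hT.iterate l
      filter_upwards [hcont.continuousAt.eventually ((hU k).isOpen_compl.mem_nhds hzk)]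
        with y hy hyk
      exact absurd hyk hy
  have ht : ∀ w, ∃ t : ℤ, ∀ l ∈ Set.Iio (L + K), ∀ k : Fin 2,
      (T ^ l) ((T ^ t) (x (q w))) ∈ U k → (T ^ l) z ∈ U k := by
    intro w
    have hzw := hMx (q w) (hqM w ▸ hz)
    obtain ⟨_, hy, t, rfl⟩ := mem_closure_iff_nhds.1 hzw _ hnhds
    exact ⟨t, hy⟩
  choose t ht using ht
  obtain ⟨l, hl, hmod⟩ := exists_lt_prod_forall_modEq (fun w => (q w).2.1) hqinj t fun w => c w
  have hvisit : ∀ w : Fin K → Fin 2, ∃ d : Fin K, (T ^ (l + d : ℕ)) z ∈ U (w d) := by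
    intro w
    obtain ⟨i, hi₁, hi₂⟩ := exists_mem_Ico_of_bounded_gaps hn (l + t w)
    obtain ⟨d, hd⟩ := Int.eq_ofNat_of_zero_le (sub_nonneg.2 hi₁)
    have hdK : d < K := by lia
    have hni : n i = ((l + d : ℕ) : ℤ) + t w := by push_cast; lia
    refine ⟨⟨d, hdK⟩, ht w (l + d) (by simp only [Set.mem_Iio]; lia) _ ?_⟩
    have hσd := hσ w ⟨d, hdK⟩
    have hr : n i % ((q w : ℕ) : ℤ) = (c w + d : ℕ) := by
      have h₁ : n i ≡ (c w + d : ℕ) [ZMOD (q w : ℕ)] := by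
        convert (hmod w).add_right (d : ℤ) using 1 <;> push_cast <;> lia
      rw [h₁.eq]
      refine Int.emod_eq_of_lt (by positivity) ?_
      exact_mod_cast hσd.1.trans_le (q w).2.2
    have hxi := hx (q w) i
    simp only [hr, Int.toNat_natCast, hσd.2] at hxi
    rw [hni, zpow_add, zpow_natCast] at hxi
    exact hxi
  obtain ⟨d, hd⟩ := hvisit fun d => if (T ^ (l + d : ℕ)) z ∈ U 0 then 1 else 0
  split_ifs at hd with h₀
  · exact Set.disjoint_left.1 hdisj h₀ hd
  · exact h₀ hd
end

section
/- Let T be a homeomorphism of a compact metric space X. If (X,T) has a weak horseshoe with bounded-gap-hitting times, then (X,T) has positive topological entropy. -/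
open Dynamics Uniformity ExpGrowth in
/-- If, for some `m`, dynamical nets for the entourage `V` at time `m * N` have at least `2 ^ N`
points for every `N`, then the topological entropy is positive. -/
theorem coverEntropy_pos_of_two_pow_le_netMaxcard {X : Type*} [UniformSpace X] {T : X → X}
    {F : Set X} {V : SetRel X X} (hV : V ∈ 𝓤 X) {m : ℕ} (hm : m ≠ 0)
    (h : ∀ N : ℕ, ((2 ^ N : ℕ) : ℕ∞) ≤ netMaxcard T F V (m * N)) :
    0 < coverEntropy T F := by
  have hle : netEntropyEntourage T F V ≤ coverEntropy T F :=
    (netEntropyEntourage_le_coverEntropyEntourage T F).trans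
      (coverEntropyEntourage_le_coverEntropy T F hV)
  refine lt_of_lt_of_le ?_ hle
  by_contra! hneg
  have hmono : Monotone fun n : ℕ ↦ (netMaxcard T F V n : ENNReal) :=
    fun _ _ hab ↦ ENat.toENNReal_mono (netMaxcard_monotone_time T F V hab)
  have hgrowth : ENNReal.log 2 ≤ m * netEntropyEntourage T F V := by
    rw [netEntropyEntourage, ← hmono.expGrowthSup_comp_mul hm, ← expGrowthSup_pow]
    refine expGrowthSup_monotone fun N ↦ ?_
    simpa using ENat.toENNReal_mono (h N)
  have hlog : 0 < ENNReal.log 2 := by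
    rw [ENNReal.zero_lt_log_iff]
    exact ENNReal.one_lt_two
  exact absurd (hlog.trans_le hgrowth)
    (not_lt.2 (EReal.mul_nonpos_iff.2 (Or.inl ⟨Nat.cast_nonneg' m, hneg⟩)))

/-- A sequence of integers whose consecutive gaps lie in `(0, K)` advances by at most `K` per
step. -/
theorem Int.sub_le_mul_of_gap_lt {n : ℤ → ℤ} {K : ℤ}
    (hgap : ∀ i : ℤ, 0 < n (i + 1) - n i ∧ n (i + 1) - n i < K) (i : ℕ) :
    n i - n 0 ≤ i * K := by
  induction i with
  | zero => simp
  | succ i ih =>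
    have := hgap i
    push_cast
    linarith

open Dynamics Uniformity UniformSpace in
/-- If the orbits of `y s`, for `s : Fin N → Fin 2`, visit `U (s i)` at a time `t i < n`, and the
`V`-neighbourhoods of `U 0` and `U 1` are disjoint, then the points `y s` form a dynamical net. -/
theorem two_pow_le_netMaxcard_of_forall_mem {X : Type*} {T : X → X} {V : SetRel X X}
    (hrefl : ∀ x, x ∈ ball x V) {U : Fin 2 → Set X}
    (hU : Disjoint (⋃ x ∈ U 0, ball x V) (⋃ x ∈ U 1, ball x V)) {N n : ℕ} {t : Fin N → ℕ}
    (ht : ∀ i, t i < n) (y : (Fin N → Fin 2) → X) (hy : ∀ s i, T^[t i] (y s) ∈ U (s i)) :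
    ((2 ^ N : ℕ) : ℕ∞) ≤ netMaxcard T Set.univ V n := by
  classical
  have hball {a b : Fin 2} (hab : a ≠ b) {p q z : X} (hp : p ∈ U a) (hq : q ∈ U b)
      (hzp : z ∈ ball p V) (hzq : z ∈ ball q V) : False := by
    have hmem {c : Fin 2} {r : X} (hr : r ∈ U c) (hz : z ∈ ball r V) :
        z ∈ ⋃ x ∈ U c, ball x V := Set.mem_biUnion hr hz
    have h0 := hmem hp hzp
    have h1 := hmem hq hzq
    rw [Set.disjoint_left] at hU
    fin_cases a <;> fin_cases b
    · exact hab rfl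
    · exact hU h0 h1
    · exact hU h1 h0
    · exact hab rfl
  have hdisj (s s' : Fin N → Fin 2) (hne : s ≠ s') :
      Disjoint (ball (y s) (dynEntourage T V n)) (ball (y s') (dynEntourage T V n)) := by
    obtain ⟨i, hi⟩ := Function.ne_iff.1 hne
    refine Set.disjoint_left.2 fun z hz hz' ↦ ?_
    exact hball hi (hy s i) (hy s' i) (mem_ball_dynEntourage.1 hz _ (ht i))
      (mem_ball_dynEntourage.1 hz' _ (ht i))
  have hinj : Function.Injective y := by
    intro s s' hss
    by_contra hne
    obtain ⟨i, hi⟩ := Function.ne_iff.1 hne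
    exact hball hi (hy s i) (hss ▸ hy s' i) (hrefl _) (hrefl _)
  have hnet : IsDynNetIn T Set.univ V n (Finset.univ.image y : Finset X) := by
    refine ⟨Set.subset_univ _, ?_⟩
    rw [Finset.coe_image, Finset.coe_univ, Set.image_univ]
    rintro _ ⟨s, rfl⟩ _ ⟨s', rfl⟩ hne
    exact hdisj s s' fun hs ↦ hne (congrArg y hs)
  simpa [Finset.card_image_of_injective _ hinj] using hnet.card_le_netMaxcard

/-- A homeomorphism of a compact metric space with a weak horseshoe with
bounded-gap-hitting times has positive topological entropy. -/
theorem hasWeakHorseshoeBGH_posEntropy {X : Type*} [MetricSpace X] [CompactSpace X]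
    (T : Equiv.Perm X) (hT : Continuous T) (hT' : Continuous T.symm)
    (h : HasWeakHorseshoeBGH T) :
    0 < Dynamics.coverEntropy (⇑T) Set.univ := by
  obtain ⟨U, K, n, hclosed, -, hdisj, hK, hgap, hs⟩ := h
  obtain ⟨V, hV, hVdisj⟩ := hdisj.exists_uniform_thickening (hclosed 0).isCompact (hclosed 1)
  have hmono : StrictMono n := strictMono_int_of_lt_succ fun i ↦ by linarith [(hgap i).1]
  choose x hx using hs
  refine coverEntropy_pos_of_two_pow_le_netMaxcard hV (m := K.toNat) (by lia) fun N ↦ ?_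
  have hnonneg (i : Fin N) : 0 ≤ n i - n 0 := by
    linarith [hmono.monotone (Int.natCast_nonneg (i : ℕ))]
  -- the symbol word `s` on the times `n 0, …, n (N - 1)`, extended by `0` elsewhere
  let word (s : Fin N → Fin 2) : ℤ → Fin 2 :=
    Function.extend (fun i : Fin N ↦ n i) s 0
  have hword (s : Fin N → Fin 2) (i : Fin N) : word s (n i) = s i := by
    refine Function.Injective.extend_apply (f := fun i : Fin N ↦ n i) (fun a b hab ↦ ?_) s 0 i
    exact Fin.ext (by exact_mod_cast hmono.injective hab)
  refine two_pow_le_netMaxcard_of_forall_mem (fun z ↦ UniformSpace.mem_ball_self z hV) hVdisj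
    (t := fun i ↦ (n i - n 0).toNat) (fun i ↦ ?_) (fun s ↦ (T ^ n 0) (x (word s))) fun s i ↦ ?_
  · have h1 := Int.sub_le_mul_of_gap_lt hgap i
    have h2 : ((i : ℕ) : ℤ) + 1 ≤ N := by exact_mod_cast i.2
    have h3 : n i - n 0 < K * N := by nlinarith
    zify
    rwa [Int.toNat_of_nonneg (hnonneg i), Int.toNat_of_nonneg hK.le]
  · have hmem := hx (word s) i
    rw [hword] at hmem
    rw [← Equiv.Perm.coe_pow, ← Equiv.Perm.mul_apply, ← zpow_natCast,
      Int.toNat_of_nonneg (hnonneg i), ← zpow_add, sub_add_cancel]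
    exact hmem
end

section
/- If ℤ = B_1 ∪ B_2 ∪ ⋯ ∪ B_q is a partition (or covering) of ℤ into finitely many sets, then at least one of the sets B_1, …, B_q is piecewise syndetic. -/
/-- A subset `F ⊆ ℤ` is *thick* if it contains arbitrarily long blocks of consecutive
integers. -/
def ThickSet (F : Set ℤ) : Prop :=
  ∀ n : ℕ, ∃ m : ℤ, ∀ k : ℕ, k ≤ n → m + (k : ℤ) ∈ F

/-- A subset `F ⊆ ℤ` is *syndetic* if it can be enumerated as `{s i}_{i ∈ ℤ}` with
`0 < s (i+1) - s i ≤ K` for some `K > 0` and all `i` (bounded gaps). -/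
def SyndeticSet (F : Set ℤ) : Prop :=
  ∃ (s : ℤ → ℤ) (K : ℤ), 0 < K ∧ (∀ i, s i ∈ F) ∧ (∀ x ∈ F, ∃ i, s i = x) ∧
    ∀ i : ℤ, 0 < s (i + 1) - s i ∧ s (i + 1) - s i ≤ K

/-- A subset of `ℤ` is *piecewise syndetic* if it is the intersection of a thick set and a
syndetic set. -/
def PiecewiseSyndeticSet (F : Set ℤ) : Prop :=
  ∃ T S : Set ℤ, ThickSet T ∧ SyndeticSet S ∧ F = T ∩ S

/-- A set of integers meeting every window of length `K` is syndetic. -/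
theorem syndeticSet_of_forall_exists_mem {S : Set ℤ} {K : ℤ}
    (hS : ∀ x, ∃ y ∈ S, x ≤ y ∧ y < x + K) : SyndeticSet S := by
  classical
  have hK : 0 < K := by
    obtain ⟨y, -, h₁, h₂⟩ := hS 0
    omega
  have : Nonempty S := by
    obtain ⟨y, hy, -⟩ := hS 0
    exact ⟨⟨y, hy⟩⟩
  have : NoMaxOrder S := ⟨fun a => by
    obtain ⟨y, hy, h, -⟩ := hS (a + 1)
    exact ⟨⟨y, hy⟩, Subtype.coe_lt_coe.1 (by simpa using (by omega : (a : ℤ) < y))⟩⟩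
  have : NoMinOrder S := ⟨fun a => by
    obtain ⟨y, hy, -, h⟩ := hS (a - K)
    exact ⟨⟨y, hy⟩, Subtype.coe_lt_coe.1 (by simpa using (by omega : y < (a : ℤ)))⟩⟩
  let : LocallyFiniteOrder S := Subtype.instLocallyFiniteOrder (· ∈ S)
  let : SuccOrder S := LinearLocallyFiniteOrder.succOrder S
  let : PredOrder S := LinearLocallyFiniteOrder.predOrder S
  let e : S ≃o ℤ := orderIsoIntOfLinearSuccPredArch
  refine ⟨fun i => e.symm i, K, hK, fun i => (e.symm i).2,
    fun x hx => ⟨e ⟨x, hx⟩, by simp⟩, fun i => ⟨?_, ?_⟩⟩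
  · have h : e.symm i < e.symm (i + 1) := e.symm.lt_iff_lt.2 (by omega)
    exact sub_pos.2 (Subtype.coe_lt_coe.2 h)
  · obtain ⟨y, hy, h₁, h₂⟩ := hS (e.symm i + 1)
    have hlt : e.symm i < ⟨y, hy⟩ := Subtype.coe_lt_coe.1 (by simpa using (by omega))
    have hle : e.symm (i + 1) ≤ ⟨y, hy⟩ :=
      (OrderIso.symm_apply_le e).2 (Int.add_one_le_iff.2 ((OrderIso.symm_apply_lt e).1 hlt))
    have hle' : (e.symm (i + 1) : ℤ) ≤ y := Subtype.coe_le_coe.2 hle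
    dsimp only
    omega

/-- If the points having an element of `F` within distance less than `K` to their right form a
thick set, then `F` is piecewise syndetic. -/
theorem piecewiseSyndeticSet_of_thickSet {F : Set ℤ} {K : ℤ} (hK : 0 < K)
    (hF : ThickSet {x | ∃ y ∈ F, x ≤ y ∧ y < x + K}) : PiecewiseSyndeticSet F := by
  refine ⟨_, F ∪ {x | ∃ y ∈ F, x ≤ y ∧ y < x + K}ᶜ, hF,
    syndeticSet_of_forall_exists_mem (K := K) fun x => ?_, ?_⟩
  · by_cases hx : ∃ y ∈ F, x ≤ y ∧ y < x + K
    · obtain ⟨y, hy, h⟩ := hx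
      exact ⟨y, Or.inl hy, h⟩
    · exact ⟨x, Or.inr hx, le_rfl, by omega⟩
  · have hsub : F ⊆ {x | ∃ y ∈ F, x ≤ y ∧ y < x + K} :=
      fun x hx => ⟨x, hx, le_rfl, by omega⟩
    rw [Set.inter_union_distrib_left, Set.inter_compl_self, Set.union_empty,
      Set.inter_eq_right.2 hsub]

/-- If a union of two sets is thick, then the first is piecewise syndetic or the second is
thick. -/
theorem ThickSet.piecewiseSyndeticSet_or_thickSet {A C : Set ℤ} (h : ThickSet (A ∪ C)) :
    PiecewiseSyndeticSet A ∨ ThickSet C := by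
  refine or_iff_not_imp_left.2 fun hA K => ?_
  have hnot : ¬ ThickSet {x | ∃ y ∈ A, x ≤ y ∧ y < x + ((K : ℤ) + 1)} :=
    fun hT => hA (piecewiseSyndeticSet_of_thickSet (by omega) hT)
  simp only [ThickSet, not_forall, not_exists] at hnot
  obtain ⟨n, hn⟩ := hnot
  obtain ⟨m, hm⟩ := h (n + K)
  obtain ⟨k, hk, hx⟩ := hn m
  refine ⟨m + k, fun j hj => ?_⟩
  have hmem := hm (k + j) (by omega)
  rw [Nat.cast_add, ← add_assoc] at hmem
  exact hmem.resolve_left fun hy => hx ⟨_, hy, by omega, by omega⟩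

/-- If a finite union of sets is thick, then one of them is piecewise syndetic. -/
theorem ThickSet.exists_piecewiseSyndeticSet {ι : Type*} (s : Finset ι) (B : ι → Set ℤ)
    (h : ThickSet (⋃ i ∈ s, B i)) : ∃ i ∈ s, PiecewiseSyndeticSet (B i) := by
  classical
  induction s using Finset.induction_on with
  | empty =>
    obtain ⟨m, hm⟩ := h 0
    simpa using hm 0 le_rfl
  | insert a s _ ih =>
    rw [Finset.set_biUnion_insert] at h
    obtain ha | hs := h.piecewiseSyndeticSet_or_thickSet
    · exact ⟨a, Finset.mem_insert_self a s, ha⟩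
    · obtain ⟨i, hi, hBi⟩ := ih hs
      exact ⟨i, Finset.mem_insert_of_mem hi, hBi⟩

/-- If `ℤ` is covered by finitely many sets `B 1, …, B q`, then at least one of them is
piecewise syndetic. -/
theorem exists_piecewiseSyndetic_of_cover (q : ℕ) (B : Fin q → Set ℤ)
    (hB : (⋃ i, B i) = Set.univ) :
    ∃ i, PiecewiseSyndeticSet (B i) := by
  obtain ⟨i, -, hi⟩ := ThickSet.exists_piecewiseSyndeticSet Finset.univ B
    (by simp only [Finset.mem_univ, Set.iUnion_true, hB]; exact fun _ => ⟨0, fun _ _ => trivial⟩)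
  exact ⟨i, hi⟩
end

section
/- Let p, ℓ ∈ ℕ with p ≥ 2. For any integer m ≥ 4ℓ + 2 and any sequence {A_n}_{n∈ℤ} of subsets of {0,1,…,p−1}^m with |A_n| ≤ ℓ for each n ∈ ℤ, there exists x ∈ {0,1,…,p−1}^ℤ such that the word x[n, n+m−1] = (x(n), x(n+1), …, x(n+m−1)) does not belong to A_n for every n ∈ ℤ. -/
/-- Lists of length `n` over `α` (latest letter first) each of whose suffixes of length `k ≥ 1`
has its first `m` letters outside `F k`. -/
def goodLists {α : Type*} [Fintype α] [DecidableEq α] (m : ℕ) (F : ℕ → Finset (List α)) :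
    ℕ → Finset (List α)
  | 0 => {[]}
  | n + 1 => ((Finset.univ ×ˢ goodLists m F n).image (fun q : α × List α => q.1 :: q.2)).filter
      (fun l => l.take m ∉ F (n + 1))

section goodLists

variable {α : Type*} [Fintype α] [DecidableEq α] {m : ℕ} {F : ℕ → Finset (List α)}

theorem exists_cons_of_mem_goodLists_succ {n : ℕ} {l : List α}
    (h : l ∈ goodLists m F (n + 1)) : ∃ c t, l = c :: t ∧ t ∈ goodLists m F n := by
  simp only [goodLists, Finset.mem_filter, Finset.mem_image, Finset.mem_product, Prod.exists] at h
  obtain ⟨⟨c, t, ⟨-, ht⟩, rfl⟩, -⟩ := h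
  exact ⟨c, t, rfl, ht⟩

theorem length_of_mem_goodLists {n : ℕ} {l : List α} (h : l ∈ goodLists m F n) :
    l.length = n := by
  induction n generalizing l with
  | zero => simp_all [goodLists]
  | succ n ih =>
    obtain ⟨c, t, rfl, ht⟩ := exists_cons_of_mem_goodLists_succ h
    simp [ih ht]

theorem drop_mem_goodLists {n k : ℕ} {l : List α} (h : l ∈ goodLists m F (n + k)) :
    l.drop k ∈ goodLists m F n := by
  induction k generalizing l with
  | zero => simpa using h
  | succ k ih =>
    obtain ⟨c, t, rfl, ht⟩ := exists_cons_of_mem_goodLists_succ (n := n + k) h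
    simpa using ih ht

theorem take_notMem_of_mem_goodLists {n : ℕ} {l : List α} (h : l ∈ goodLists m F (n + 1)) :
    l.take m ∉ F (n + 1) := by
  simp only [goodLists, Finset.mem_filter] at h
  exact h.2

/-- A one-letter extension of a good list fails to be good only if its first `m` letters are
forbidden. -/
theorem card_mul_card_goodLists_eq (n : ℕ) :
    Fintype.card α * (goodLists m F n).card = (goodLists m F (n + 1)).card +
      (((Finset.univ ×ˢ goodLists m F n).image (fun q : α × List α => q.1 :: q.2)).filter
        (fun l => l.take m ∈ F (n + 1))).card := by
  have hinj : Function.Injective (fun q : α × List α => q.1 :: q.2) := by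
    rintro ⟨a, s⟩ ⟨b, t⟩ h
    simpa using h
  rw [← Finset.card_univ, ← Finset.card_product, ← Finset.card_image_of_injective _ hinj,
    add_comm, goodLists, Finset.card_filter_add_card_filter_not]

theorem card_mul_card_goodLists_le_add {d : ℕ} {F : ℕ → Finset (List α)} (k : ℕ) :
    Fintype.card α * (goodLists (d + 1) F (k + d)).card ≤
      (goodLists (d + 1) F (k + d + 1)).card +
        (F (k + d + 1)).card * (goodLists (d + 1) F k).card := by
  rw [card_mul_card_goodLists_eq, ← Finset.card_product]
  gcongr
  refine (Finset.card_le_card ?_).trans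
    (Finset.card_image_le (f := fun q : List α × List α => q.1 ++ q.2))
  intro l hl
  simp only [Finset.mem_filter, Finset.mem_image, Finset.mem_product, Prod.exists] at hl ⊢
  obtain ⟨⟨c, t, ⟨-, ht⟩, rfl⟩, hbad⟩ := hl
  exact ⟨_, (c :: t).drop (d + 1), ⟨hbad, by simpa using drop_mem_goodLists ht⟩,
    List.take_append_drop _ _⟩

/-- The number of good lists grows at least by a factor `3 / 2` at every step. -/
theorem three_mul_card_goodLists_le {d ℓ : ℕ} {F : ℕ → Finset (List α)}
    (hα : 2 ≤ Fintype.card α) (hℓ : 2 * ℓ * 2 ^ d ≤ 3 ^ d)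
    (hF : ∀ n, (F n).card ≤ ℓ) (hF₀ : ∀ n ≤ d, F n = ∅) (n : ℕ) :
    3 * (goodLists (d + 1) F n).card ≤ 2 * (goodLists (d + 1) F (n + 1)).card := by
  induction n using Nat.strong_induction_on with
  | _ n ih =>
  rcases lt_or_ge n d with hn | hn
  · have h := card_mul_card_goodLists_eq (m := d + 1) (F := F) n
    have := Nat.mul_le_mul_right (goodLists (d + 1) F n).card hα
    simp only [hF₀ (n + 1) hn, Finset.notMem_empty, Finset.filter_false, Finset.card_empty] at h
    omega
  · obtain ⟨k, rfl⟩ := Nat.exists_eq_add_of_le' hn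
    have hgrow : ∀ i ≤ d, 3 ^ i * (goodLists (d + 1) F k).card ≤
        2 ^ i * (goodLists (d + 1) F (k + i)).card := by
      intro i
      induction i with
      | zero => simp
      | succ i ihi =>
        intro hi
        have h₁ := ihi (by omega)
        have h₂ := Nat.mul_le_mul_left (2 ^ i) (ih (k + i) (by omega))
        rw [← add_assoc, pow_succ, pow_succ]
        linarith
    have h₁ := card_mul_card_goodLists_le_add (d := d) (F := F) k
    have h₂ := Nat.mul_le_mul_right (goodLists (d + 1) F (k + d)).card hα
    have h₃ := Nat.mul_le_mul_right (goodLists (d + 1) F k).card (hF (k + d + 1))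
    have h₄ : 2 * ℓ * (goodLists (d + 1) F k).card ≤ (goodLists (d + 1) F (k + d)).card := by
      refine le_of_mul_le_mul_left ?_ (pow_pos two_pos d)
      have := Nat.mul_le_mul_right (goodLists (d + 1) F k).card hℓ
      linarith [hgrow d le_rfl]
    linarith

theorem goodLists_nonempty {d ℓ : ℕ} {F : ℕ → Finset (List α)}
    (hα : 2 ≤ Fintype.card α) (hℓ : 2 * ℓ * 2 ^ d ≤ 3 ^ d)
    (hF : ∀ n, (F n).card ≤ ℓ) (hF₀ : ∀ n ≤ d, F n = ∅) (n : ℕ) :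
    (goodLists (d + 1) F n).Nonempty := by
  induction n with
  | zero => simp [goodLists]
  | succ n ih =>
    have := three_mul_card_goodLists_le hα hℓ hF hF₀ n
    rw [← Finset.card_pos] at ih ⊢
    omega

end goodLists

theorem two_mul_mul_two_pow_le_three_pow {ℓ d : ℕ} (hd : 4 * ℓ + 1 ≤ d) :
    2 * ℓ * 2 ^ d ≤ 3 ^ d := by
  induction d, hd using Nat.le_induction with
  | base =>
    induction ℓ with
    | zero => simp
    | succ ℓ ih =>
      rcases Nat.eq_zero_or_pos ℓ with rfl | h
      · norm_num
      · rw [show 4 * (ℓ + 1) + 1 = (4 * ℓ + 1) + 4 by ring, pow_add _ (4 * ℓ + 1),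
          pow_add _ (4 * ℓ + 1)]
        have : 2 ^ (4 * ℓ + 1) ≤ ℓ * 2 ^ (4 * ℓ + 1) := Nat.le_mul_of_pos_left _ h
        linarith [Nat.zero_le (3 ^ (4 * ℓ + 1))]
  | succ d _ ih =>
    rw [pow_succ, pow_succ]
    linarith [Nat.zero_le (3 ^ d)]

/-- Finitely many of the avoidance conditions, at nonnegative positions, can be met. -/
theorem exists_seq_avoiding_words_of_lt {p ℓ m : ℕ} (hp : 2 ≤ p) (hm : 4 * ℓ + 2 ≤ m)
    (A : ℕ → Finset (Fin m → Fin p)) (hA : ∀ n, (A n).card ≤ ℓ) (N : ℕ) :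
    ∃ x : ℕ → Fin p, ∀ n < N, (fun k : Fin m => x (n + k)) ∉ A n := by
  obtain ⟨d, rfl⟩ : ∃ d, m = d + 1 := ⟨m - 1, by omega⟩
  set F : ℕ → Finset (List (Fin p)) := fun n => if n ≤ d then ∅ else
    (A (n - (d + 1))).image (fun w => List.ofFn fun i => w i.rev) with hFdef
  have hF : ∀ n, (F n).card ≤ ℓ := by
    intro n
    by_cases h : n ≤ d
    · simp [hFdef, h]
    · simpa [hFdef, h] using Finset.card_image_le.trans (hA _)
  obtain ⟨l, hl⟩ := goodLists_nonempty (d := d) (by simpa using hp)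
    (two_mul_mul_two_pow_le_three_pow (by omega)) hF (fun n h => by simp [hFdef, h]) (N + d)
  have hlen := length_of_mem_goodLists hl
  refine ⟨fun i => l.getD (N + d - 1 - i) ⟨0, by omega⟩, fun n hn hmem => ?_⟩
  obtain ⟨r, rfl⟩ : ∃ r, N = n + 1 + r := ⟨N - (n + 1), by omega⟩
  have hdrop : l.drop r ∈ goodLists (d + 1) F (n + d + 1) :=
    drop_mem_goodLists (by convert hl using 2; omega)
  refine take_notMem_of_mem_goodLists hdrop ?_
  simp only [hFdef, show ¬ n + d + 1 ≤ d by omega, if_false, Finset.mem_image]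
  refine ⟨_, by simpa [show n + d + 1 - (d + 1) = n by omega] using hmem, ?_⟩
  refine List.ext_getElem (by simp; omega) fun i h₁ h₂ => ?_
  have hi : i < d + 1 := by simpa using h₁
  simp only [List.getElem_ofFn, List.getElem_take, List.getElem_drop, Fin.val_rev]
  rw [List.getElem?_eq_getElem (by omega), Option.getD_some]
  congr 1
  omega

/-- Let `p, ℓ ∈ ℕ` with `p ≥ 2`. For any `m ≥ 4ℓ + 2` and any family `{A n}_{n ∈ ℤ}` of sets
of words of length `m` over the alphabet `{0, …, p-1}` with `|A n| ≤ ℓ` for every `n`, there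
is a two-sided sequence `x` whose word `x[n, n+m-1]` avoids `A n` for every `n ∈ ℤ`. -/
theorem exists_seq_avoiding_words (p ℓ m : ℕ) (hp : 2 ≤ p) (hm : 4 * ℓ + 2 ≤ m)
    (A : ℤ → Finset (Fin m → Fin p)) (hA : ∀ n : ℤ, (A n).card ≤ ℓ) :
    ∃ x : ℤ → Fin p, ∀ n : ℤ, (fun k : Fin m => x (n + (k : ℕ))) ∉ A n := by
  let D : ℕ → Set (ℤ → Fin p) := fun N =>
    {x | ∀ n : ℤ, |n| ≤ N → (fun k : Fin m => x (n + (k : ℕ))) ∉ A n}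
  have hclosed : ∀ N, IsClosed (D N) := by
    intro N
    simp only [D, Set.ofPred_forall]
    refine isClosed_iInter fun n => isClosed_iInter fun _ => ?_
    have hcont : Continuous (fun (x : ℤ → Fin p) (k : Fin m) => x (n + (k : ℕ))) := by fun_prop
    exact (isClosed_discrete {w | w ∉ A n}).preimage hcont
  have hne : ∀ N, (D N).Nonempty := by
    intro N
    obtain ⟨y, hy⟩ := exists_seq_avoiding_words_of_lt hp hm (fun n => A (n - N))
      (fun n => hA _) (2 * N + 1)
    refine ⟨fun z => y (z + N).toNat, fun n hn => ?_⟩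
    obtain ⟨h₁, h₂⟩ := abs_le.mp hn
    have h := hy (n + N).toNat (by omega)
    rw [Int.toNat_of_nonneg (by omega), add_sub_cancel_right] at h
    convert h using 4
    omega
  obtain ⟨x, hx⟩ := IsCompact.nonempty_iInter_of_sequence_nonempty_isCompact_isClosed D
    (fun N x hx n hn => hx n (hn.trans (by push_cast; omega))) hne
    (hclosed 0).isCompact hclosed
  exact ⟨x, fun n => Set.mem_iInter.mp hx n.natAbs n (by simp)⟩
end

section
/- Let T be a homeomorphism of a compact metric space X, let U_0, U_1 be two disjoint nonempty closed subsets of X, and let F ⊂ ℤ. If for each n ∈ ℕ there exists r_n ∈ ℤ such that r_n + (F ∩ [−n,n]) ∈ Ind_T(U_0,U_1), then F ∈ Ind_T(U_0,U_1). -/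
/-- `IndT T U` is the collection of subsets `J ⊆ ℤ` such that for every `s ∈ {0,1}^J` there
exists `x` with `T^j x ∈ U (s j)` for every `j ∈ J`. -/
def IndT {X : Type*} (T : Equiv.Perm X) (U : Fin 2 → Set X) : Set (Set ℤ) :=
  {J | ∀ s : ℤ → Fin 2, ∃ x : X, ∀ j ∈ J, (T ^ j) x ∈ U (s j)}

theorem Equiv.Perm.continuous_zpow {X : Type*} [TopologicalSpace X] {T : Equiv.Perm X}
    (hT : Continuous T) (hT' : Continuous T.symm) (j : ℤ) : Continuous (T ^ j : Equiv.Perm X) := by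
  have key : ∀ (S : Equiv.Perm X), Continuous S → ∀ n : ℕ, Continuous (S ^ n : Equiv.Perm X) := by
    intro S hS n
    rw [Equiv.Perm.coe_pow]
    exact hS.iterate n
  cases j with
  | ofNat n => simpa using key T hT n
  | negSucc n =>
    rw [zpow_negSucc, ← inv_pow]
    exact key T⁻¹ hT' (n + 1)

/-- If for each `n ∈ ℕ` some translate of `F ∩ [-n, n]` belongs to `Ind_T(U 0, U 1)`,
then `F ∈ Ind_T(U 0, U 1)`. -/
theorem mem_IndT_of_translates {X : Type*} [MetricSpace X] [CompactSpace X]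
    (T : Equiv.Perm X) (hT : Continuous T) (hT' : Continuous T.symm)
    (U : Fin 2 → Set X) (hcl : ∀ k, IsClosed (U k)) (hne : ∀ k, (U k).Nonempty)
    (hdisj : Disjoint (U 0) (U 1)) (F : Set ℤ) (r : ℕ → ℤ)
    (h : ∀ n : ℕ, (fun x => r n + x) '' (F ∩ Set.Icc (-(n : ℤ)) (n : ℤ)) ∈ IndT T U) :
    F ∈ IndT T U := by
  intro s
  let K : ℕ → Set X := fun n => ⋂ j ∈ F ∩ Set.Icc (-(n : ℤ)) (n : ℤ), (T ^ j) ⁻¹' U (s j)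
  have hKcl : ∀ n, IsClosed (K n) := fun n =>
    isClosed_biInter fun j _ => (hcl (s j)).preimage (Equiv.Perm.continuous_zpow hT hT' j)
  have hKanti : ∀ n, K (n + 1) ⊆ K n := fun n =>
    Set.biInter_subset_biInter_left
      (Set.inter_subset_inter_right F (Set.Icc_subset_Icc (by lia) (by lia)))
  have hKne : ∀ n, (K n).Nonempty := by
    intro n
    obtain ⟨x, hx⟩ := h n fun j => s (j - r n)
    refine ⟨(T ^ r n) x, Set.mem_iInter₂.2 fun j hj => ?_⟩
    have hxj := hx (r n + j) ⟨j, hj, rfl⟩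
    rwa [add_sub_cancel_left, add_comm, zpow_add, Equiv.Perm.mul_apply] at hxj
  obtain ⟨x, hx⟩ := IsCompact.nonempty_iInter_of_sequence_nonempty_isCompact_isClosed K hKanti
    hKne (hKcl 0).isCompact hKcl
  refine ⟨x, fun j hj => ?_⟩
  exact Set.mem_iInter₂.1 (Set.mem_iInter.1 hx j.natAbs) j ⟨hj, by lia, by lia⟩
end

section
/- Let B ⊂ ℤ be piecewise syndetic. Then there exists a syndetic set F = {b_i}_{i∈ℤ} ⊂ ℤ such that for every n ∈ ℕ there exists p_n ∈ ℤ with p_n + {b_{−n}, …, b_{−1}, b_0, b_1, …, b_n} ⊂ B. -/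
/-- An integer sequence whose gaps lie in `[1, K]` grows at a rate between `1` and `K`. -/
theorem sub_bounds_of_gap_bounds {s : ℤ → ℤ} {K : ℤ}
    (hs : ∀ i : ℤ, 0 < s (i + 1) - s i ∧ s (i + 1) - s i ≤ K) {i k : ℤ} (hik : i ≤ k) :
    k - i ≤ s k - s i ∧ s k - s i ≤ K * (k - i) := by
  induction k, hik using Int.leInduction with
  | base => simp
  | succ k _ ih =>
    have h := hs k
    constructor
    · linarith [ih.1]
    · linarith [ih.2]

/-- A sequence of integers with gaps in `[1, K]` has a term in every window `(c - K, c]`. -/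
theorem exists_mem_window_of_gap_bounds {s : ℤ → ℤ} {K : ℤ}
    (hs : ∀ i : ℤ, 0 < s (i + 1) - s i ∧ s (i + 1) - s i ≤ K) (c : ℤ) :
    ∃ i, s i ≤ c ∧ c < s i + K := by
  obtain ⟨i, hi, hmax⟩ := Int.exists_greatest_of_bdd (P := fun i => s i ≤ c)
    ⟨max 0 (c - s 0), fun i hi => by
      by_contra! h
      have := (sub_bounds_of_gap_bounds hs (show 0 ≤ i by omega)).1
      omega⟩
    ⟨min 0 (c - s 0), by
      have := (sub_bounds_of_gap_bounds hs (min_le_left 0 (c - s 0))).1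
      omega⟩
  refine ⟨i, hi, ?_⟩
  by_contra! h
  have := hmax (i + 1) (by linarith [(hs i).2])
  omega

/-- In a sequence of integers with gaps in `[1, K]`, arbitrarily long blocks of consecutive terms
lie in a given thick set. -/
theorem ThickSet.exists_block {T : Set ℤ} (hT : ThickSet T) {s : ℤ → ℤ} {K : ℤ}
    (hs : ∀ i : ℤ, 0 < s (i + 1) - s i ∧ s (i + 1) - s i ≤ K) (n : ℕ) :
    ∃ i, ∀ j : ℤ, |j| ≤ n → s (i + j) ∈ T := by
  obtain ⟨m, hm⟩ := hT (K * (2 * n + 1)).toNat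
  obtain ⟨i, hi, hi'⟩ := exists_mem_window_of_gap_bounds hs (m + K * (n + 1))
  refine ⟨i, fun j hj => ?_⟩
  obtain ⟨hj₁, hj₂⟩ := abs_le.mp hj
  have hlow : s i - K * n ≤ s (i + j) := by
    have h₁ := (sub_bounds_of_gap_bounds hs (show i - n ≤ i + j by omega)).1
    have h₂ := (sub_bounds_of_gap_bounds hs (show i - n ≤ i by omega)).2
    ring_nf at h₁ h₂ ⊢
    linarith
  have hupp : s (i + j) ≤ s i + K * n := by
    have h₁ := (sub_bounds_of_gap_bounds hs (show i + j ≤ i + n by omega)).1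
    have h₂ := (sub_bounds_of_gap_bounds hs (show i ≤ i + n by omega)).2
    ring_nf at h₁ h₂ ⊢
    linarith
  have hm' := hm (s (i + j) - m).toNat (by
    apply Int.toNat_le_toNat
    linarith)
  rwa [Int.toNat_of_nonneg (by linarith), add_sub_cancel] at hm'

/-- A pointwise bounded sequence of integer-valued functions converges pointwise along any
ultrafilter. -/
theorem exists_eventually_eq_of_abs_le {α ι : Type*} (U : Ultrafilter ι) (f : ι → α → ℤ)
    (C : α → ℤ) (hf : ∀ n j, |f n j| ≤ C j) :
    ∃ b : α → ℤ, ∀ j, ∀ᶠ n in (U : Filter ι), f n j = b j := by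
  refine Classical.axiomOfChoice (r := fun j b => ∀ᶠ n in (U : Filter ι), f n j = b) fun j => ?_
  have h : ∀ᶠ n in (U : Filter ι), ∃ b ∈ Set.Icc (-C j) (C j), f n j = b :=
    Filter.Eventually.of_forall fun n => ⟨_, abs_le.mp (hf n j), rfl⟩
  obtain ⟨b, -, hb⟩ := (Ultrafilter.eventually_exists_mem_iff (Set.finite_Icc _ _)).mp h
  exact ⟨b, hb⟩

/-- A piecewise syndetic set `B ⊆ ℤ` admits a syndetic set `F = {b i}_{i ∈ ℤ}` such that for
every `n ∈ ℕ` some translate of `{b (-n), …, b n}` lies inside `B`. -/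
theorem piecewiseSyndetic_exists_syndetic_translates (B : Set ℤ)
    (hB : PiecewiseSyndeticSet B) :
    ∃ (b : ℤ → ℤ) (K : ℤ), 0 < K ∧
      (∀ i : ℤ, 0 < b (i + 1) - b i ∧ b (i + 1) - b i ≤ K) ∧
      ∀ n : ℕ, ∃ p : ℤ, ∀ i : ℤ, |i| ≤ (n : ℤ) → p + b i ∈ B := by
  obtain ⟨T, S, hT, ⟨s, K, hK, hsS, -, hs⟩, rfl⟩ := hB
  choose c hc using hT.exists_block hs
  have habs : ∀ n j, |s (c n + j) - s (c n)| ≤ K * |j| := by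
    intro n j
    rcases le_total 0 j with hj | hj
    · have h := sub_bounds_of_gap_bounds hs (show c n ≤ c n + j by omega)
      rw [abs_of_nonneg hj, abs_of_nonneg (by linarith)]
      linarith [h.2, show K * (c n + j - c n) = K * j by ring]
    · have h := sub_bounds_of_gap_bounds hs (show c n + j ≤ c n by omega)
      rw [abs_of_nonpos hj, abs_of_nonpos (by linarith)]
      linarith [h.2, show K * (c n - (c n + j)) = K * -j by ring]
  obtain ⟨b, hb⟩ := exists_eventually_eq_of_abs_le (Filter.hyperfilter ℕ) _ _ habs
  refine ⟨b, K, hK, fun i => ?_, fun n => ?_⟩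
  · obtain ⟨m, h₁, h₂⟩ := ((hb i).and (hb (i + 1))).exists
    have h := hs (c m + i)
    rw [add_assoc] at h
    rw [← h₁, ← h₂]
    simpa using h
  · have hlim : ∀ᶠ m in (Filter.hyperfilter ℕ : Filter ℕ),
        ∀ j ∈ Set.Icc (-(n : ℤ)) n, s (c m + j) - s (c m) = b j :=
      (Set.finite_Icc _ _).eventually_all.mpr fun j _ => hb j
    have hlarge : ∀ᶠ m in (Filter.hyperfilter ℕ : Filter ℕ), n ≤ m :=
      (Filter.eventually_ge_atTop n).filter_mono Nat.hyperfilter_le_atTop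
    obtain ⟨m, hm, hnm⟩ := (hlim.and hlarge).exists
    refine ⟨s (c m), fun i hi => ?_⟩
    rw [← hm i (abs_le.mp hi), add_sub_cancel]
    exact ⟨hc m i (hi.trans (by exact_mod_cast hnm)), hsS _⟩
end
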